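/- Let P ⊂ ℝ^d be a bounded rational convex polytope and let J_P(T) = Σ_{r≥1} |(1/r)ℤ^d ∩ P| T^r. Then J_P(T) is (the Taylor series of) a rational function of the form g(T)/(1−T^δ)^{d+1} for some polynomial g and any integer δ ≥ 1 with δP integral, J_P has degree 0 as a rational function, and lim_{T→∞} J_P(T) = −1. -/

import Mathlib

open Pointwise
namespace Ehr

open Classical in
/-- Euler characteristic lemma for compact intervals. -/
lemma euler_intervals {J : Type*} [Fintype J] (c : J → ℚ) (I : J → Set ℝ)
    (hI : ∀ j, (I j).Nonempty → ∃ a b, a ≤ b ∧ I j = Set.Icc a b)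
    (h : ∀ t, ∑ j, c j * (if t ∈ I j then 1 else 0) = 0) :
    ∑ j, c j * (if (I j).Nonempty then 1 else 0) = 0 := by
  have hI' : ∀ j, ∃ a b : ℝ, (I j).Nonempty → a ≤ b ∧ I j = Set.Icc a b := by
    intro j
    by_cases hj : (I j).Nonempty
    · obtain ⟨a, b, hab⟩ := hI j hj
      exact ⟨a, b, fun _ => hab⟩
    · exact ⟨0, 0, fun h => absurd h hj⟩
  choose a b hab using hI'
  obtain ⟨ε, hε, hεa, hεb⟩ : ∃ ε : ℝ, 0 < ε ∧ (∀ j k, b k < a j → b k + ε < a j) ∧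
      (∀ j k, b k < b j → b k + ε < b j) := by
    have key : ∀ x y : ℝ, ∀ᶠ ε in nhdsWithin (0 : ℝ) (Set.Ioi 0), x < y → x + ε < y := by
      intro x y
      by_cases hxy : x < y
      · have : ∀ᶠ ε in nhds (0 : ℝ), ε < y - x := eventually_lt_nhds (by linarith)
        filter_upwards [nhdsWithin_le_nhds this] with ε hε _
        linarith
      · exact Filter.Eventually.of_forall fun _ h => absurd h hxy
    have h1 : ∀ᶠ ε in nhdsWithin (0 : ℝ) (Set.Ioi 0), ∀ j k, b k < a j → b k + ε < a j := by
      rw [Filter.eventually_all]; intro j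
      rw [Filter.eventually_all]; intro k
      exact key _ _
    have h2 : ∀ᶠ ε in nhdsWithin (0 : ℝ) (Set.Ioi 0), ∀ j k, b k < b j → b k + ε < b j := by
      rw [Filter.eventually_all]; intro j
      rw [Filter.eventually_all]; intro k
      exact key _ _
    have h3 : ∀ᶠ ε in nhdsWithin (0 : ℝ) (Set.Ioi 0), 0 < ε := self_mem_nhdsWithin
    obtain ⟨ε, h⟩ := (h3.and (h1.and h2)).exists
    exact ⟨ε, h⟩
  set T : Finset ℝ := Finset.univ.image b with hT
  have hj : ∀ j, (if (I j).Nonempty then (1 : ℚ) else 0) =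
      ∑ t ∈ T, ((if t ∈ I j then (1 : ℚ) else 0) - (if t + ε ∈ I j then 1 else 0)) := by
    intro j
    by_cases hne : (I j).Nonempty
    · obtain ⟨h1, h2⟩ := hab j hne
      rw [if_pos hne, Finset.sum_eq_single (b j)]
      · rw [h2, if_pos ⟨h1, le_rfl⟩, if_neg]
        · norm_num
        · rintro ⟨_, h⟩; linarith
      · intro t ht hne'
        obtain ⟨k, -, rfl⟩ := Finset.mem_image.1 ht
        have h3 := hεa j k
        have h4 := hεb j k
        rw [sub_eq_zero]
        congr 1
        rw [h2, Set.mem_Icc, Set.mem_Icc]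
        apply propext
        constructor
        · rintro ⟨h5, h6⟩
          exact ⟨by linarith, (h4 (lt_of_le_of_ne h6 hne')).le⟩
        · rintro ⟨h5, h6⟩
          refine ⟨?_, by linarith⟩
          by_contra h7
          linarith [h3 (not_le.1 h7)]
      · intro h; exact absurd (Finset.mem_image_of_mem b (Finset.mem_univ j)) h
    · have : I j = ∅ := Set.not_nonempty_iff_eq_empty.1 hne
      simp [this]
  simp_rw [hj, Finset.mul_sum]
  rw [Finset.sum_comm]
  simp_rw [mul_sub, Finset.sum_sub_distrib, h]
  simp

variable {ι : Type*} [Fintype ι] [DecidableEq ι]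

/-- Cone over the vectors indexed by `S`. -/
def K {E : Type*} [AddCommGroup E] [Module ℝ E] (w : ι → E) (S : Finset ι) : Set E :=
  {x | ∃ l : ι → ℝ, (∀ i, 0 ≤ l i) ∧ (∀ i, i ∉ S → l i = 0) ∧ ∑ i, l i • w i = x}

/-- Linear independence of the subfamily. -/
def Ind {E : Type*} [AddCommGroup E] [Module ℝ E] (w : ι → E) (S : Finset ι) : Prop :=
  ∀ l : ι → ℝ, (∀ i, i ∉ S → l i = 0) → ∑ i, l i • w i = 0 → ∀ i, l i = 0

open Classical in
/-- indicator -/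
noncomputable def ind {E : Type*} (A : Set E) : E → ℚ := fun x => if x ∈ A then 1 else 0

section
variable {E : Type*} [NormedAddCommGroup E] [NormedSpace ℝ E] (w : ι → E) (ht : E →ₗ[ℝ] ℝ)

lemma mem_K_insert (S : Finset ι) (i : ι) (x : E) :
    x ∈ K w (insert i S) ↔ ∃ t : ℝ, 0 ≤ t ∧ x - t • w i ∈ K w S := by
  constructor
  · rintro ⟨l, h0, hS, rfl⟩
    by_cases hi : i ∈ S
    · refine ⟨0, le_rfl, l, h0, ?_, by simp⟩
      rwa [Finset.insert_eq_of_mem hi] at hS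
    · refine ⟨l i, h0 i, Function.update l i 0, ?_, ?_, ?_⟩
      · intro j
        by_cases hj : j = i
        · subst hj; simp
        · simp [hj, h0]
      · intro j hj
        by_cases hj' : j = i
        · subst hj'; simp
        · simp [hj', hS j, hj]
      · rw [eq_sub_iff_add_eq, ← Finset.sum_erase_add _ _ (Finset.mem_univ i),
          ← Finset.sum_erase_add (a := i) _ (fun i => l i • w i) (Finset.mem_univ i)]
        simp only [Function.update_self, zero_smul, add_zero]
        congr 1
        apply Finset.sum_congr rfl
        intro j hj
        rw [Function.update_of_ne (Finset.ne_of_mem_erase hj)]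
  · rintro ⟨t, ht, l, h0, hS, h⟩
    refine ⟨l + Pi.single i t, ?_, ?_, ?_⟩
    · intro j
      have : (0 : ι → ℝ) ≤ Pi.single i t := Pi.single_nonneg.2 ht
      exact add_nonneg (h0 j) (this j)
    · intro j hj
      rw [Finset.mem_insert, not_or] at hj
      simp [hS j hj.2, hj.1]
    · simp only [Pi.add_apply, add_smul, Finset.sum_add_distrib, h]
      rw [Finset.sum_eq_single i]
      · simp
      · intro j _ hj; simp [hj]
      · simp

lemma interval (hw : ∀ i, 0 < ht (w i)) (S : Finset ι) (i : ι) (x : E)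
    (hne : {t : ℝ | 0 ≤ t ∧ x - t • w i ∈ K w S}.Nonempty) :
    ∃ a b, a ≤ b ∧ {t : ℝ | 0 ≤ t ∧ x - t • w i ∈ K w S} = Set.Icc a b := by
  set I := {t : ℝ | 0 ≤ t ∧ x - t • w i ∈ K w S} with hI
  have hconv : Convex ℝ I := by
    rintro t ⟨ht0, l, hl, hlS, hlx⟩ t' ⟨ht0', l', hl', hlS', hlx'⟩ a b ha hb hab
    refine ⟨by simp only [smul_eq_mul]; positivity, fun j => a * l j + b * l' j, ?_, ?_, ?_⟩
    · intro j; have := hl j; have := hl' j; positivity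
    · intro j hj; simp [hlS j hj, hlS' j hj]
    · simp only [add_smul, mul_smul, Finset.sum_add_distrib, ← Finset.smul_sum, hlx, hlx',
        smul_eq_mul]
      have : x = a • x + b • x := by rw [← add_smul, hab, one_smul]
      conv_rhs => rw [this]
      module
  have hcomp : IsCompact I := by
    set C : Set (ℝ × (ι → ℝ)) := {p | 0 ≤ p.1 ∧ (∀ j, 0 ≤ p.2 j) ∧ (∀ j, j ∉ S → p.2 j = 0) ∧
      p.1 • w i + ∑ j, p.2 j • w j = x} with hC
    have hCcl : IsClosed C := by
      simp only [hC, Set.ofPred_and, Set.ofPred_forall]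
      refine IsClosed.inter (isClosed_le continuous_const (by fun_prop)) (IsClosed.inter ?_
        (IsClosed.inter ?_ ?_))
      · exact isClosed_iInter fun j => isClosed_le continuous_const (by fun_prop)
      · exact isClosed_iInter fun j => isClosed_iInter fun _ =>
          isClosed_eq (by fun_prop) continuous_const
      · exact isClosed_eq (by fun_prop) continuous_const
    have hCsub : C ⊆ Set.Icc (0 : ℝ × (ι → ℝ)) (ht x / ht (w i), fun j => ht x / ht (w j)) := by
      rintro ⟨t, l⟩ ⟨h1, h2, h3, h4⟩
      simp only at h1 h2 h3 h4
      have h5 : t * ht (w i) + ∑ j, l j * ht (w j) = ht x := by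
        rw [← h4]; simp
      have h6 : ∀ j, 0 ≤ l j * ht (w j) := fun j => mul_nonneg (h2 j) (hw j).le
      refine ⟨⟨h1, h2⟩, ⟨?_, fun j => ?_⟩⟩
      · show t ≤ _
        rw [le_div_iff₀ (hw i)]
        have := Finset.sum_nonneg (s := Finset.univ) fun j _ => h6 j
        linarith
      · show l j ≤ _
        rw [le_div_iff₀ (hw j)]
        have := Finset.single_le_sum (s := Finset.univ) (fun j _ => h6 j) (Finset.mem_univ j)
        have := mul_nonneg h1 (hw i).le
        linarith
    have hCc : IsCompact C := isCompact_Icc.of_isClosed_subset hCcl hCsub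
    have : I = Prod.fst '' C := by
      ext t
      constructor
      · rintro ⟨h0, l, hl, hlS, h⟩
        exact ⟨(t, l), ⟨h0, hl, hlS, by simp [h]⟩, rfl⟩
      · rintro ⟨⟨t, l⟩, ⟨h0, hl, hlS, h⟩, rfl⟩
        exact ⟨h0, l, hl, hlS, by rw [← h]; simp⟩
    rw [this]
    exact hCc.image continuous_fst
  have := eq_Icc_of_connected_compact (hconv.isConnected hne) hcomp
  refine ⟨sInf I, sSup I, ?_, this⟩
  rw [this] at hne
  exact Set.nonempty_Icc.1 hne

lemma conv_step (hw : ∀ i, 0 < ht (w i)) (i : ι) (c : Finset ι → ℚ)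
    (h : ∀ x, ∑ S, c S * ind (K w S) x = 0) (x : E) :
    ∑ S, c S * ind (K w (insert i S)) x = 0 := by
  have := euler_intervals (J := Option (Finset ι)) (fun o => o.elim 0 c)
    (fun o => o.elim ∅ fun S => {t : ℝ | 0 ≤ t ∧ x - t • w i ∈ K w S}) ?_ ?_
  · rw [Fintype.sum_option] at this
    simp only [Option.elim, zero_mul, zero_add] at this
    rw [← this]
    apply Finset.sum_congr rfl
    intro S _
    congr 1
    unfold ind
    congr 1
    rw [mem_K_insert]
    rfl
  · rintro (_ | S)
    · simp
    · exact interval w ht hw S i x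
  · intro t
    rw [Fintype.sum_option]
    simp only [Option.elim, zero_mul, zero_add]
    by_cases h0 : 0 ≤ t
    · refine Eq.trans ?_ (h (x - t • w i))
      apply Finset.sum_congr rfl
      intro S _
      congr 1
      unfold ind
      congr 1
      exact propext ⟨And.right, And.intro h0⟩
    · simp [h0]

lemma circuit (hw : ∀ i, 0 < ht (w i)) (S : Finset ι) (hS : Ind w S) (i : ι) :
    ind (K w (insert i S)) ∈ Submodule.span ℚ
      {F : E → ℚ | ∃ S : Finset ι, S.Nonempty ∧ Ind w S ∧ F = ind (K w S)} := by
  by_cases hT : Ind w (insert i S)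
  · exact Submodule.subset_span ⟨_, Finset.insert_nonempty _ _, hT, rfl⟩
  have hiS : i ∉ S := by
    intro h; rw [Finset.insert_eq_of_mem h] at hT; exact hT hS
  obtain ⟨μ, hμS, hμ⟩ : ∃ μ : ι → ℝ, (∀ j, j ∉ S → μ j = 0) ∧ ∑ j, μ j • w j = w i := by
    unfold Ind at hT
    push Not at hT
    obtain ⟨l, hl, hl0, k, hk⟩ := hT
    have hli : l i ≠ 0 := by
      intro h0
      refine hk (hS l ?_ hl0 k)
      intro j hj
      by_cases hji : j = i
      · rw [hji, h0]
      · exact hl j (by simp [hji, hj])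
    refine ⟨fun j => -(l i)⁻¹ * l j + Pi.single (M := fun _ => ℝ) i 1 j, ?_, ?_⟩
    · intro j hj
      by_cases hji : j = i
      · subst hji; simp [hli]
      · simp [hji, hl j, hj]
    · simp only [add_smul, mul_smul, Finset.sum_add_distrib, ← Finset.smul_sum, hl0]
      simp [Pi.single_apply]
  have hμi : μ i = 0 := hμS i hiS
  -- comparison of two relations
  have hrel : ∀ l : ι → ℝ, (∀ j, j ∉ insert i S → l j = 0) → ∑ j, l j • w j = 0 →
      ∀ j, j ≠ i → l j = - l i * μ j := by
    intro l hl hl0 j hji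
    have := hS (fun j => l j + l i * μ j - Pi.single (M := fun _ => ℝ) i (l i) j) ?_ ?_ j
    · simp [hji] at this; linarith
    · intro k hk
      by_cases hki : k = i
      · subst hki; simp [hμi]
      · simp [hki, hl k, hk, hμS k hk]
    · simp only [add_smul, sub_smul, mul_smul, Finset.sum_add_distrib, Finset.sum_sub_distrib,
        ← Finset.smul_sum, hl0, hμ]
      simp [Pi.single_apply]
  set A : Finset ι := S.filter (fun j => 0 < μ j) with hA
  have hAmem : ∀ a ∈ A, a ∈ S ∧ 0 < μ a := fun a ha => by simpa [hA] using ha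
  have hAi : ∀ a ∈ A, a ≠ i := fun a ha h => hiS (h ▸ (hAmem a ha).1)
  have hAne : A.Nonempty := by
    by_contra h
    rw [Finset.not_nonempty_iff_eq_empty, Finset.filter_eq_empty_iff] at h
    have h1 : ht (w i) = ∑ j, μ j * ht (w j) := by rw [← hμ]; simp
    have h2 : ∑ j, μ j * ht (w j) ≤ 0 := by
      apply Finset.sum_nonpos
      intro j _
      by_cases hj : j ∈ S
      · exact mul_nonpos_of_nonpos_of_nonneg (not_lt.1 (h hj)) (hw j).le
      · simp [hμS j hj]
    linarith [hw i]
  have hsum : ∑ A' ∈ A.powerset, (-1 : ℚ) ^ A'.card • ind (K w (insert i S \ A')) = 0 := by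
    funext x
    simp only [Finset.sum_apply, Pi.smul_apply, smul_eq_mul, Pi.zero_apply]
    by_cases hx : x ∈ K w (insert i S)
    · obtain ⟨l, hl, hlS, hlx⟩ := hx
      obtain ⟨m, hm, hmin⟩ := Finset.exists_min_image A (fun a => l a / μ a) hAne
      set θ := l m / μ m with hθ
      have hθ0 : 0 ≤ θ := div_nonneg (hl m) (hAmem m hm).2.le
      set l' : ι → ℝ := fun j => l j - θ * μ j + Pi.single (M := fun _ => ℝ) i θ j with hl'
      have hl'0 : ∀ j, 0 ≤ l' j := by
        intro j
        have h1 : (0 : ℝ) ≤ Pi.single (M := fun _ => ℝ) i θ j :=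
          (Pi.single_nonneg.2 hθ0 : (0 : ι → ℝ) ≤ Pi.single i θ) j
        have h2 : θ * μ j ≤ l j := by
          by_cases hj : j ∈ A
          · have := hmin j hj
            rwa [le_div_iff₀ (hAmem j hj).2] at this
          · have : μ j ≤ 0 := by
              by_cases hjS : j ∈ S
              · simpa [hA, hjS] using hj
              · rw [hμS j hjS]
            have := mul_nonpos_of_nonneg_of_nonpos hθ0 this
            linarith [hl j]
        simp only [hl']; linarith
      have hl'S : ∀ j, j ∉ insert i S → l' j = 0 := by
        intro j hj
        have h1 := hlS j hj
        rw [Finset.mem_insert, not_or] at hj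
        simp [hl', h1, hμS j hj.2, hj.1]
      have hl'x : ∑ j, l' j • w j = x := by
        simp only [hl', add_smul, sub_smul, mul_smul, Finset.sum_add_distrib,
          Finset.sum_sub_distrib, ← Finset.smul_sum, hlx, hμ]
        simp [Pi.single_apply]
      set Z := A.filter (fun a => l' a = 0) with hZ
      have hmZ : m ∈ Z := by
        rw [hZ, Finset.mem_filter]
        refine ⟨hm, ?_⟩
        have := (hAmem m hm).2
        simp only [hl', hθ, Pi.single_apply, if_neg (hAi m hm)]
        field_simp
        simp
      have hiff : ∀ A' ∈ A.powerset, (x ∈ K w (insert i S \ A') ↔ A' ⊆ Z) := by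
        intro A' hA'
        rw [Finset.mem_powerset] at hA'
        constructor
        · rintro ⟨l2, h1, h2, h3⟩ a ha
          rw [hZ, Finset.mem_filter]
          refine ⟨hA' ha, ?_⟩
          have h4 := hrel (fun j => l2 j - l' j) ?_ ?_
          · have h5 := h4 m (hAi m hm)
            have h6 := h4 a (hAi a (hA' ha))
            have h7 : l2 a = 0 := h2 a (by simp [ha])
            have h8 : l' m = 0 := (Finset.mem_filter.1 hmZ).2
            have h9 := h1 m
            have h10 := (hAmem m hm).2
            have h11 := (hAmem a (hA' ha)).2
            have h12 : 0 ≤ -(l2 i - l' i) := by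
              by_contra hneg
              push Not at hneg
              have := mul_neg_of_neg_of_pos hneg h10
              linarith
            have h13 := mul_nonneg h12 h11.le
            have := hl'0 a
            linarith
          · intro j hj
            rw [hl'S j hj, h2 j (fun h => hj (Finset.mem_sdiff.1 h).1), sub_zero]
          · simp only [sub_smul, Finset.sum_sub_distrib, h3, hl'x, sub_self]
        · intro hZ'
          refine ⟨l', hl'0, ?_, hl'x⟩
          intro j hj
          by_cases hjT : j ∈ insert i S
          · have : j ∈ A' := by
              by_contra h; exact hj (Finset.mem_sdiff.2 ⟨hjT, h⟩)
            exact (Finset.mem_filter.1 (hZ' this)).2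
          · exact hl'S j hjT
      have h1 : ∑ A' ∈ A.powerset, (-1 : ℚ) ^ A'.card * ind (K w (insert i S \ A')) x =
          ∑ A' ∈ A.powerset, if A' ⊆ Z then (-1 : ℚ) ^ A'.card else 0 := by
        apply Finset.sum_congr rfl
        intro A' hA'
        simp [ind, hiff A' hA']
      rw [h1, ← Finset.sum_filter]
      have h2 : A.powerset.filter (fun A' => A' ⊆ Z) = Z.powerset := by
        ext A'
        simp only [Finset.mem_filter, Finset.mem_powerset]
        exact ⟨fun h => h.2, fun h => ⟨h.trans (Finset.filter_subset _ _), h⟩⟩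
      rw [h2]
      have := Finset.sum_powerset_neg_one_pow_card_of_nonempty ⟨m, hmZ⟩
      exact_mod_cast this
    · apply Finset.sum_eq_zero
      intro A' _
      have : x ∉ K w (insert i S \ A') := by
        rintro ⟨l, h1, h2, h3⟩
        exact hx ⟨l, h1, fun j hj => h2 j (fun h => hj (Finset.mem_sdiff.1 h).1), h3⟩
      simp [ind, this]
  rw [← Finset.add_sum_erase _ _ (Finset.empty_mem_powerset A)] at hsum
  simp only [Finset.card_empty, pow_zero, one_smul, Finset.sdiff_empty] at hsum
  rw [eq_neg_of_add_eq_zero_left hsum]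
  apply Submodule.neg_mem
  apply Submodule.sum_mem
  intro A' hA'
  rw [Finset.mem_erase, Finset.mem_powerset] at hA'
  obtain ⟨hne, hsub⟩ := hA'
  obtain ⟨a, ha⟩ := Finset.nonempty_iff_ne_empty.2 hne
  apply Submodule.smul_mem
  apply Submodule.subset_span
  refine ⟨_, ⟨i, ?_⟩, ?_, rfl⟩
  · rw [Finset.mem_sdiff]
    exact ⟨Finset.mem_insert_self _ _, fun h => hAi i (hsub h) rfl⟩
  · intro l hl hl0
    have h1 := hrel l (fun j hj => hl j (fun h => hj (Finset.mem_sdiff.1 h).1)) hl0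
    have h2 := h1 a (hAi a (hsub ha))
    rw [hl a (by simp [ha])] at h2
    have h3 := (hAmem a (hsub ha)).2
    have h4 : l i = 0 := by
      rcases mul_eq_zero.1 h2.symm with h | h
      · linarith
      · linarith
    intro j
    by_cases hj : j = i
    · rw [hj, h4]
    · rw [h1 j hj, h4]; simp

lemma cone_mem_span (hw : ∀ i, 0 < ht (w i)) (S : Finset ι)
    (hS : S.Nonempty) : ind (K w S) ∈ Submodule.span ℚ
      {F : E → ℚ | ∃ S : Finset ι, S.Nonempty ∧ Ind w S ∧ F = ind (K w S)} := by
  induction hS using Finset.Nonempty.cons_induction with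
  | singleton i =>
    have : Ind w (∅ : Finset ι) := fun l hl _ j => hl j (by simp)
    simpa using circuit w ht hw ∅ this i
  | cons i S hi hS ih =>
    rw [Finset.cons_eq_insert]
    have h1 : {F : E → ℚ | ∃ S : Finset ι, S.Nonempty ∧ Ind w S ∧ F = ind (K w S)} =
        (fun S => ind (K w S)) '' {S : Finset ι | S.Nonempty ∧ Ind w S} := by
      ext F
      constructor
      · rintro ⟨S, h1, h2, rfl⟩; exact ⟨S, ⟨h1, h2⟩, rfl⟩
      · rintro ⟨S, ⟨h1, h2⟩, rfl⟩; exact ⟨S, h1, h2, rfl⟩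
    have ih' := ih
    rw [h1, Finsupp.mem_span_image_iff_linearCombination] at ih'
    obtain ⟨c, hc', hcl⟩ := ih'
    have hsum : ∑ S', c S' • ind (K w S') = ind (K w S) := by
      rw [← hcl, Finsupp.linearCombination_apply, Finsupp.sum_fintype]
      simp
    have h2 := conv_step w ht hw i (fun S' => c S' - Pi.single (M := fun _ => ℚ) S 1 S') ?_
    · have h3 : ind (K w (insert i S)) = ∑ S', c S' • ind (K w (insert i S')) := by
        funext x
        have := h2 x
        simp only [sub_mul, Finset.sum_sub_distrib, Pi.single_apply, ite_mul, one_mul, zero_mul,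
          Finset.sum_ite_eq', Finset.mem_univ, if_true] at this
        simp only [Finset.sum_apply, Pi.smul_apply, smul_eq_mul]
        linarith
      rw [h3]
      apply Submodule.sum_mem
      intro S' _
      by_cases h0 : c S' = 0
      · simp [h0]
      · apply Submodule.smul_mem
        exact circuit w ht hw S' (hc' (Finsupp.mem_support_iff.2 h0)).2 i
    · intro x
      have := congrFun hsum x
      simp only [Finset.sum_apply, Pi.smul_apply, smul_eq_mul] at this
      simp only [sub_mul, Finset.sum_sub_distrib, Pi.single_apply, ite_mul, one_mul, zero_mul,
          Finset.sum_ite_eq', Finset.mem_univ, if_true]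
      linarith
end
section count
variable {d : ℕ} (δ : ℕ) (v : ι → Fin d → ℤ)

/-- lifted generators -/
def wv (i : ι) : (Fin d → ℝ) × ℝ := (fun j => (v i j : ℝ), (δ : ℝ))

/-- lattice points at height `n` -/
def pt (x : Fin d → ℤ) (n : ℕ) : (Fin d → ℝ) × ℝ := (fun j => (x j : ℝ), (n : ℝ))

/-- partially truncated cone, at level `n` -/
def KA (S A : Finset ι) (n : ℕ) : Set (Fin d → ℤ) :=
  {x | ∃ l : ι → ℝ, (∀ i, 0 ≤ l i) ∧ (∀ i, i ∉ S → l i = 0) ∧ (∀ i ∈ A, l i < 1) ∧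
    ∑ i, l i • wv δ v i = pt x n}

lemma sum_wv_iff (l : ι → ℝ) (x : Fin d → ℤ) (n : ℕ) : ∑ i, l i • wv δ v i = pt x n ↔
    (∀ j, ∑ i, l i * (v i j : ℝ) = x j) ∧ ∑ i, l i * (δ : ℝ) = n := by
  simp [wv, pt, Prod.ext_iff, funext_iff, Prod.fst_sum, Prod.snd_sum, Finset.sum_apply]

lemma pt_mem_K (S : Finset ι) (x : Fin d → ℤ) (n : ℕ) :
    pt x n ∈ K (wv δ v) S ↔ x ∈ KA δ v S ∅ n := by
  simp [K, KA]

/-- bounding box -/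
noncomputable def box (M n : ℕ) : Finset (Fin d → ℤ) :=
  Finset.Icc (fun _ => -((M * n : ℕ) : ℤ)) (fun _ => ((M * n : ℕ) : ℤ))

lemma KA_subset_box (hδ : 1 ≤ δ) (M : ℕ) (hM : ∀ i j, |v i j| ≤ M) (S A : Finset ι) (n : ℕ) :
    KA δ v S A n ⊆ (box M n : Finset (Fin d → ℤ)) := by
  rintro x ⟨l, hl, -, -, h⟩
  rw [sum_wv_iff] at h
  obtain ⟨h1, h2⟩ := h
  have key : ∀ j, |x j| ≤ ((M * n : ℕ) : ℤ) := by
    intro j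
    have : |(x j : ℝ)| ≤ M * n := by
      rw [← h1 j, ← h2, Finset.mul_sum]
      refine (Finset.abs_sum_le_sum_abs _ _).trans (Finset.sum_le_sum fun i _ => ?_)
      rw [abs_mul, abs_of_nonneg (hl i)]
      have h3 : |(v i j : ℝ)| ≤ M := by exact_mod_cast hM i j
      have h4 : (1 : ℝ) ≤ δ := by exact_mod_cast hδ
      have h5 : l i ≤ l i * δ := le_mul_of_one_le_right (hl i) h4
      calc l i * |(v i j : ℝ)| ≤ (l i * δ) * M := by
            apply mul_le_mul h5 h3 (abs_nonneg _) (by have := hl i; positivity)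
        _ = _ := by ring
    exact_mod_cast this
  simp only [box, Finset.coe_Icc, Set.mem_Icc, Pi.le_def]
  exact ⟨fun j => (abs_le.1 (key j)).1, fun j => (abs_le.1 (key j)).2⟩

lemma KA_finite (hδ : 1 ≤ δ) (S A : Finset ι) (n : ℕ) : (KA δ v S A n).Finite := by
  set M : ℕ := ∑ i, ∑ j, (v i j).natAbs with hMdef
  refine (Finset.finite_toSet _).subset (KA_subset_box δ v hδ M ?_ S A n)
  intro i j
  rw [Int.abs_eq_natAbs]
  norm_cast
  have h1 := Finset.single_le_sum (f := fun j => (v i j).natAbs) (s := Finset.univ)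
    (fun _ _ => Nat.zero_le _) (Finset.mem_univ j)
  have h2 := Finset.single_le_sum (f := fun i => ∑ j, (v i j).natAbs) (s := Finset.univ)
    (fun _ _ => Nat.zero_le _) (Finset.mem_univ i)
  exact h1.trans h2

lemma KA_rec (hδ : 1 ≤ δ) (S A : Finset ι) (hS : Ind (wv δ v) S) (a : ι) (ha : a ∈ S)
    (haA : a ∉ A) (n : ℕ) : (KA δ v S A n).ncard =
      (KA δ v S (insert a A) n).ncard + if δ ≤ n then (KA δ v S A (n - δ)).ncard else 0 := by
  split_ifs with hn
  · have himg : KA δ v S A n = KA δ v S (insert a A) n ∪ (fun x => x + v a) '' KA δ v S A (n - δ) := by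
      ext x
      constructor
      · rintro ⟨l, h1, h2, h3, h4⟩
        by_cases hla : l a < 1
        · left
          refine ⟨l, h1, h2, ?_, h4⟩
          intro i hi
          rcases Finset.mem_insert.1 hi with rfl | hi
          · exact hla
          · exact h3 i hi
        · right
          push Not at hla
          refine ⟨x - v a, ⟨fun i => l i - Pi.single (M := fun _ => ℝ) a 1 i, ?_, ?_, ?_, ?_⟩, by simp⟩
          · intro i
            by_cases hi : i = a
            · subst hi; simpa using hla
            · simpa [hi] using h1 i
          · intro i hi
            have : i ≠ a := fun h => hi (h ▸ ha)
            simp [this, h2 i hi]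
          · intro i hi
            have : i ≠ a := fun h => haA (h ▸ hi)
            simp [this, h3 i hi]
          · simp only [sub_smul, Finset.sum_sub_distrib, h4]
            simp [Pi.single_apply, pt, wv, Nat.cast_sub hn]
            rfl
      · rintro (⟨l, h1, h2, h3, h4⟩ | ⟨y, ⟨l, h1, h2, h3, h4⟩, rfl⟩)
        · exact ⟨l, h1, h2, fun i hi => h3 i (Finset.mem_insert_of_mem hi), h4⟩
        · refine ⟨fun i => l i + Pi.single (M := fun _ => ℝ) a 1 i, ?_, ?_, ?_, ?_⟩
          · intro i
            by_cases hi : i = a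
            · subst hi; simpa using add_nonneg (h1 i) zero_le_one
            · simpa [hi] using h1 i
          · intro i hi
            have : i ≠ a := fun h => hi (h ▸ ha)
            simp [this, h2 i hi]
          · intro i hi
            have : i ≠ a := fun h => haA (h ▸ hi)
            simp [this, h3 i hi]
          · simp only [add_smul, Finset.sum_add_distrib, h4]
            simp [Pi.single_apply, pt, wv, Nat.cast_sub hn]
            rfl
    rw [himg, Set.ncard_union_eq ?_ (KA_finite δ v hδ _ _ _) ((KA_finite δ v hδ _ _ _).image _),
      Set.ncard_image_of_injective]
    · exact add_left_injective _
    · rw [Set.disjoint_left]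
      rintro x ⟨l, h1, h2, h3, h4⟩ ⟨y, ⟨l', h1', h2', h3', h4'⟩, hx⟩
      have := hS (fun i => l i - l' i - Pi.single (M := fun _ => ℝ) a 1 i) ?_ ?_ a
      · have h5 := h3 a (Finset.mem_insert_self _ _)
        have h6 := h1' a
        simp at this
        linarith
      · intro i hi
        have : i ≠ a := fun h => hi (h ▸ ha)
        simp [this, h2 i hi, h2' i hi]
      · simp only [sub_smul, Finset.sum_sub_distrib, h4, h4']
        subst hx
        ext <;> simp [Pi.single_apply, pt, wv, Nat.cast_sub hn]
  · rw [add_zero]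
    congr 1
    ext x
    constructor
    · rintro ⟨l, h1, h2, h3, h4⟩
      refine ⟨l, h1, h2, ?_, h4⟩
      intro i hi
      rcases Finset.mem_insert.1 hi with rfl | hi
      · have h5 := ((sum_wv_iff δ v l x n).1 h4).2
        have h6 : l i * δ ≤ ∑ i, l i * (δ : ℝ) :=
          Finset.single_le_sum (f := fun i => l i * (δ : ℝ))
            (fun i _ => mul_nonneg (h1 i) (Nat.cast_nonneg _)) (Finset.mem_univ i)
        have h7 : (n : ℝ) < δ := by exact_mod_cast not_le.1 hn
        have h8 : (1 : ℝ) ≤ δ := by exact_mod_cast hδ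
        by_contra h9
        push Not at h9
        nlinarith
      · exact h3 i hi
    · rintro ⟨l, h1, h2, h3, h4⟩
      exact ⟨l, h1, h2, fun i hi => h3 i (Finset.mem_insert_of_mem hi), h4⟩

/-- generating function -/
noncomputable def GF (S A : Finset ι) : PowerSeries ℚ :=
  PowerSeries.mk fun n => ((KA δ v S A n).ncard : ℚ)

lemma GF_pow (hδ : 1 ≤ δ) (S : Finset ι) (hS : Ind (wv δ v) S) (A : Finset ι) (hA : A ⊆ S) :
    (1 - PowerSeries.X ^ δ) ^ A.card * GF δ v S ∅ = GF δ v S A := by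
  induction A using Finset.induction_on with
  | empty => simp
  | insert a A ha ih =>
    rw [Finset.card_insert_of_notMem ha, pow_succ', mul_assoc,
      ih ((Finset.subset_insert _ _).trans hA)]
    ext n
    rw [sub_mul, one_mul, map_sub, PowerSeries.coeff_X_pow_mul']
    simp only [GF, PowerSeries.coeff_mk]
    rw [KA_rec δ v hδ S A hS a (hA (Finset.mem_insert_self _ _)) ha n]
    split_ifs <;> simp

lemma card_le_of_Ind (S : Finset ι) (hS : Ind (wv δ v) S) : S.card ≤ d + 1 := by
  have : LinearIndependent ℝ (fun i : S => wv δ v i) := by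
    rw [Fintype.linearIndependent_iff]
    intro g hg i
    have := hS (fun i => if h : i ∈ S then g ⟨i, h⟩ else 0) (by intro i hi; simp [hi]) ?_ i
    · simpa using this
    · rw [← hg, ← Finset.sum_subset (Finset.subset_univ S), ← Finset.sum_coe_sort S]
      · simp
      · intro i _ hi; simp [hi]
  have := this.fintype_card_le_finrank
  simpa using this

/-- the numerator bound -/
def Rat' (F : PowerSeries ℚ) : Prop := ∃ h : Polynomial ℚ, h.degree < ((δ * (d + 1) : ℕ) : WithBot ℕ) ∧
  (h : PowerSeries ℚ) = (1 - PowerSeries.X ^ δ) ^ (d + 1) * F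

lemma degree_den (hδ : 1 ≤ δ) (m : ℕ) :
    ((1 - Polynomial.X ^ δ : Polynomial ℚ) ^ m).degree = ((δ * m : ℕ) : WithBot ℕ) := by
  have h1 : (1 - Polynomial.X ^ δ : Polynomial ℚ).degree = (δ : WithBot ℕ) := by
    have : (1 - Polynomial.X ^ δ : Polynomial ℚ) = -(Polynomial.X ^ δ - Polynomial.C 1) := by simp
    rw [this, Polynomial.degree_neg, Polynomial.degree_X_pow_sub_C hδ]
  rw [Polynomial.degree_pow, h1, mul_comm δ m]
  simp

lemma GF_rat (hδ : 1 ≤ δ) (S : Finset ι) (hne : S.Nonempty) (hS : Ind (wv δ v) S) :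
    Rat' (d := d) δ (GF δ v S ∅) := by
  have hcard := card_le_of_Ind δ v S hS
  refine ⟨(1 - Polynomial.X ^ δ) ^ (d + 1 - S.card) *
    PowerSeries.trunc (δ * S.card) (GF δ v S S), ?_, ?_⟩
  · rw [Polynomial.degree_mul, degree_den δ hδ]
    have h1 := PowerSeries.degree_trunc_lt (GF δ v S S) (δ * S.card)
    have h2 : ((δ * (d + 1) : ℕ) : WithBot ℕ) =
        ((δ * (d + 1 - S.card) : ℕ) : WithBot ℕ) + ((δ * S.card : ℕ) : WithBot ℕ) := by
      rw [← Nat.cast_add, ← mul_add, Nat.sub_add_cancel hcard]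
    rw [h2]
    exact WithBot.add_lt_add_left (WithBot.coe_ne_bot) h1
  · have h1 : ((PowerSeries.trunc (δ * S.card) (GF δ v S S) : Polynomial ℚ) : PowerSeries ℚ) =
        GF δ v S S := by
      ext n
      rw [Polynomial.coeff_coe, PowerSeries.coeff_trunc]
      split_ifs with hn
      · rfl
      · symm
        simp only [GF, PowerSeries.coeff_mk]
        norm_cast
        rw [Set.ncard_eq_zero (KA_finite δ v hδ _ _ _), Set.eq_empty_iff_forall_notMem]
        rintro x ⟨l, h1, h2, h3, h4⟩
        apply hn
        have h5 := ((sum_wv_iff δ v l x n).1 h4).2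
        rw [← Finset.sum_subset (Finset.subset_univ S)
          (fun i _ hi => by simp [h2 i hi])] at h5
        have h6 : ∑ i ∈ S, l i * (δ : ℝ) < ∑ i ∈ S, (δ : ℝ) := by
          apply Finset.sum_lt_sum_of_nonempty hne
          intro i hi
          have h8 : (1 : ℝ) ≤ δ := by exact_mod_cast hδ
          nlinarith [h3 i hi]
        rw [h5] at h6
        simp only [Finset.sum_const, nsmul_eq_mul] at h6
        rw [mul_comm]
        exact_mod_cast h6
    rw [Polynomial.coe_mul, h1, ← GF_pow δ v hδ S hS S (Finset.Subset.refl _), ← mul_assoc]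
    simp only [Polynomial.coe_pow, Polynomial.coe_sub, Polynomial.coe_one, Polynomial.coe_X]
    rw [← pow_add, Nat.sub_add_cancel hcard]

lemma GF_all (hδ : 1 ≤ δ) (S : Finset ι) (hne : S.Nonempty) :
    Rat' (d := d) δ (GF δ v S ∅) := by
  set M : ℕ := ∑ i, ∑ j, (v i j).natAbs with hMdef
  have hM : ∀ i j, |v i j| ≤ M := by
    intro i j
    rw [Int.abs_eq_natAbs]
    norm_cast
    have h1 := Finset.single_le_sum (f := fun j => (v i j).natAbs) (s := Finset.univ)
      (fun _ _ => Nat.zero_le _) (Finset.mem_univ j)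
    have h2 := Finset.single_le_sum (f := fun i => ∑ j, (v i j).natAbs) (s := Finset.univ)
      (fun _ _ => Nat.zero_le _) (Finset.mem_univ i)
    exact h1.trans h2
  let Φ : ((Fin d → ℝ) × ℝ → ℚ) → PowerSeries ℚ := fun F =>
    PowerSeries.mk fun n => ∑ x ∈ box M n, F (pt x n)
  have hΦ : ∀ S, Φ (ind (K (wv δ v) S)) = GF δ v S ∅ := by
    classical
    intro S
    ext n
    simp only [Φ, GF, PowerSeries.coeff_mk, ind, pt_mem_K]
    rw [Finset.sum_boole]
    congr 1
    rw [← Set.ncard_coe_finset]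
    congr 1
    ext x
    simp only [Finset.coe_filter, Set.mem_ofPred_eq]
    exact ⟨fun h => h.2, fun h => ⟨KA_subset_box δ v hδ M hM _ _ _ h, h⟩⟩
  rw [← hΦ]
  have hmem := cone_mem_span (wv δ v) (LinearMap.snd ℝ (Fin d → ℝ) ℝ)
    (by intro i; simp only [wv, LinearMap.snd_apply]; exact_mod_cast hδ) S hne
  generalize ind (K (wv δ v) S) = F₀ at hmem ⊢
  induction hmem using Submodule.span_induction with
  | mem F hF =>
    obtain ⟨S', h1, h2, rfl⟩ := hF
    rw [hΦ]
    exact GF_rat δ v hδ S' h1 h2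
  | zero =>
    refine ⟨0, by rw [Polynomial.degree_zero]; exact WithBot.bot_lt_coe _, ?_⟩
    have : Φ 0 = 0 := by ext n; simp [Φ]
    rw [this]; simp
  | add F G _ _ hF hG =>
    obtain ⟨f, hf, hf'⟩ := hF
    obtain ⟨g, hg, hg'⟩ := hG
    refine ⟨f + g, (Polynomial.degree_add_le _ _).trans_lt (max_lt hf hg), ?_⟩
    have : Φ (F + G) = Φ F + Φ G := by ext n; simp [Φ, Finset.sum_add_distrib]
    rw [this, mul_add, Polynomial.coe_add, hf', hg']
  | smul c F _ hF =>
    obtain ⟨f, hf, hf'⟩ := hF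
    refine ⟨c • f, (Polynomial.degree_smul_le _ _).trans_lt hf, ?_⟩
    have : Φ (c • F) = c • Φ F := by ext n; simp [Φ, Finset.mul_sum]
    rw [this, Polynomial.coe_smul, hf', mul_smul_comm]
end count
end Ehr

theorem stmt15 (d : ℕ) (Vq : Finset (Fin d → ℚ)) (hne : Vq.Nonempty)
    (P : Set (Fin d → ℝ))
    (hP : P = convexHull ℝ ((fun v : Fin d → ℚ => fun i => ((v i : ℝ))) '' (Vq : Set (Fin d → ℚ))))
    (δ : ℕ) (hδ : 1 ≤ δ)
    (hint : ∀ x ∈ Set.extremePoints ℝ ((δ : ℝ) • P), ∀ i, ∃ z : ℤ, x i = (z : ℝ)) :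
    ∃ g : Polynomial ℚ,
      (g : PowerSeries ℚ) =
        (((1 - Polynomial.X ^ δ) ^ (d + 1) : Polynomial ℚ) : PowerSeries ℚ) *
          PowerSeries.mk (fun r => if 1 ≤ r then
            (Nat.card {x : Fin d → ℤ | (fun i => (x i : ℝ) / (r : ℝ)) ∈ P} : ℚ) else 0) ∧
      g.degree = ((1 - Polynomial.X ^ δ) ^ (d + 1) : Polynomial ℚ).degree ∧
      g.leadingCoeff = - ((1 - Polynomial.X ^ δ) ^ (d + 1) : Polynomial ℚ).leadingCoeff := by
  classical
  have hδ0 : (0 : ℝ) < δ := by exact_mod_cast hδ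
  set V : Set (Fin d → ℝ) := (fun v : Fin d → ℚ => fun i => ((v i : ℝ))) '' (Vq : Set (Fin d → ℚ))
    with hV
  have hVfin : ((δ : ℝ) • V).Finite := ((Finset.finite_toSet Vq).image _).smul_set
  have hQ : (δ : ℝ) • P = convexHull ℝ ((δ : ℝ) • V) := by rw [hP, convexHull_smul]
  have hext : (Set.extremePoints ℝ ((δ : ℝ) • P)).Finite := by
    rw [hQ]; exact hVfin.subset extremePoints_convexHull_subset
  have hKM : convexHull ℝ (Set.extremePoints ℝ ((δ : ℝ) • P)) = (δ : ℝ) • P := by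
    have h1 : IsCompact ((δ : ℝ) • P) := by rw [hQ]; exact hVfin.isCompact_convexHull ℝ
    have h2 : Convex ℝ ((δ : ℝ) • P) := by rw [hQ]; exact convex_convexHull _ _
    have h3 := closure_convexHull_extremePoints h1 h2
    rwa [(hext.isCompact_convexHull ℝ).isClosed.closure_eq] at h3
  set W := hext.toFinset with hW
  have hWc : (W : Set (Fin d → ℝ)) = Set.extremePoints ℝ ((δ : ℝ) • P) := hext.coe_toFinset
  rw [← hWc] at hKM
  have hPne : ((δ : ℝ) • P).Nonempty := by
    rw [hP]
    exact ((Finset.coe_nonempty.2 hne).image _).convexHull.smul_set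
  have hWne : W.Nonempty := by
    rw [← hKM, convexHull_nonempty_iff] at hPne
    exact_mod_cast hPne
  have hz : ∀ y : W, ∃ z : Fin d → ℤ, ∀ j, (y : Fin d → ℝ) j = z j := by
    intro y
    have := hint y (by rw [← hWc]; exact y.2)
    choose z hz using this
    exact ⟨z, hz⟩
  choose v hv using hz
  obtain ⟨h, hdeg, hh⟩ := Ehr.GF_all δ v hδ Finset.univ
    (by rw [Finset.univ_nonempty_iff]; exact hWne.to_subtype)
  -- identification of the generating function
  have hmem : ∀ y, y ∈ (δ : ℝ) • P ↔ ∃ l : W → ℝ, (∀ i, 0 ≤ l i) ∧ ∑ i, l i = 1 ∧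
      ∀ j, ∑ i, l i * (v i j : ℝ) = y j := by
    intro y
    rw [← hKM, Finset.mem_convexHull']
    constructor
    · rintro ⟨l, h1, h2, h3⟩
      refine ⟨fun i => l i, fun i => h1 i i.2, ?_, ?_⟩
      · rw [← h2, Finset.sum_coe_sort W l]
      · intro j
        rw [← h3, Finset.sum_apply, ← Finset.sum_coe_sort W]
        simp [hv]
    · rintro ⟨l, h1, h2, h3⟩
      refine ⟨fun i => if hi : i ∈ W then l ⟨i, hi⟩ else 0, ?_, ?_, ?_⟩
      · intro i hi; simp [hi, h1]
      · rw [← Finset.sum_coe_sort W]; simpa using h2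
      · rw [← Finset.sum_coe_sort W]
        ext j
        rw [← h3 j]
        simp [hv]
  have hset : ∀ n, 1 ≤ n → Ehr.KA δ v Finset.univ ∅ n =
      {x : Fin d → ℤ | (fun i => (x i : ℝ) / (n : ℝ)) ∈ P} := by
    intro n hn
    have hn0 : (0 : ℝ) < n := by exact_mod_cast hn
    ext x
    have e1 : (fun i => (x i : ℝ) / (n : ℝ)) ∈ P ↔
        (fun i => (δ : ℝ) * ((x i : ℝ) / (n : ℝ))) ∈ (δ : ℝ) • P := by
      rw [← Set.smul_mem_smul_set_iff₀ hδ0.ne']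
      rfl
    rw [Set.mem_ofPred_eq, e1, hmem]
    simp only [Ehr.KA, Set.mem_ofPred_eq, Ehr.sum_wv_iff]
    constructor
    · rintro ⟨l, h1, -, -, h4, h5⟩
      rw [← Finset.sum_mul] at h5
      refine ⟨fun i => l i * (δ / n), fun i => mul_nonneg (h1 i) (by positivity), ?_, ?_⟩
      · rw [← Finset.sum_mul, ← mul_div_assoc, h5, div_self hn0.ne']
      · intro j
        rw [← h4 j, Finset.sum_div, Finset.mul_sum]
        exact Finset.sum_congr rfl fun i _ => by ring
    · rintro ⟨l, h1, h2, h3⟩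
      refine ⟨fun i => l i * (n / δ), fun i => mul_nonneg (h1 i) (by positivity), by simp, by simp,
        ?_, ?_⟩
      · intro j
        have : ∀ i, l i * (n / δ) * (v i j : ℝ) = (l i * v i j) * (n / δ) := fun i => by ring
        simp_rw [this]
        rw [← Finset.sum_mul, h3 j]
        field_simp
      · rw [← Finset.sum_mul, ← Finset.sum_mul, h2]
        field_simp
  have hset0 : Ehr.KA δ v Finset.univ ∅ 0 = {0} := by
    ext x
    simp only [Ehr.KA, Set.mem_ofPred_eq, Ehr.sum_wv_iff, Set.mem_singleton_iff]
    constructor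
    · rintro ⟨l, h1, -, -, h4, h5⟩
      have h6 : ∀ i, l i = 0 := by
        intro i
        rw [Nat.cast_zero, Finset.sum_eq_zero_iff_of_nonneg
          (fun i _ => mul_nonneg (h1 i) hδ0.le)] at h5
        have := h5 i (Finset.mem_univ i)
        exact (mul_eq_zero.1 this).resolve_right hδ0.ne'
      ext j
      have := h4 j
      simp only [h6, zero_mul, Finset.sum_const_zero] at this
      exact_mod_cast this.symm
    · rintro rfl
      exact ⟨0, by simp⟩
  have hGF : Ehr.GF δ v Finset.univ ∅ = 1 + PowerSeries.mk (fun r => if 1 ≤ r then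
            (Nat.card {x : Fin d → ℤ | (fun i => (x i : ℝ) / (r : ℝ)) ∈ P} : ℚ) else 0) := by
    ext n
    simp only [Ehr.GF, PowerSeries.coeff_mk, map_add, PowerSeries.coeff_one]
    rcases Nat.eq_zero_or_pos n with rfl | hn
    · rw [hset0]; simp
    · rw [hset n hn, if_neg hn.ne', if_pos (show 1 ≤ n from hn), zero_add]
      rfl
  rw [← Ehr.degree_den δ hδ] at hdeg
  refine ⟨h - (1 - Polynomial.X ^ δ) ^ (d + 1), ?_,
    Polynomial.degree_sub_eq_right_of_degree_lt hdeg,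
    Polynomial.leadingCoeff_sub_of_degree_lt' hdeg⟩
  rw [hGF] at hh
  rw [Polynomial.coe_sub, hh]
  simp only [Polynomial.coe_pow, Polynomial.coe_sub, Polynomial.coe_one, Polynomial.coe_X]
  ring
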